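/- arXiv:2403.15548 — 2 statements merged into one kernel-verified Lean document; each statement's English description precedes it below -/
import Mathlib

section
/- Let A be an n×n real symmetric matrix, z ∈ ℝ such that z·I − A is invertible, and set G := (z·I − A)^{-1}. Let u, v ∈ ℝ^n satisfy uᵀ G v = 0, and set U := uᵀ G u, V := vᵀ G v. If U·V ≠ 1, then the matrix z·I − A − u vᵀ − v uᵀ is invertible and uᵀ (z·I − A − u vᵀ − v uᵀ)^{-1} u = U/(1 − U·V). -/
open Matrix

/-- Solving `(B - uvᵀ - vuᵀ) w = x` for `w` in terms of `B⁻¹` and the inner products of `w`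
with `u` and `v`. -/
lemma eq_inv_mulVec_of_rank_two_sub_mulVec_eq {ι R : Type*} [Fintype ι] [DecidableEq ι]
    [CommRing R] {B : Matrix ι ι R} (hB : IsUnit B) {u v w x : ι → R}
    (h : (B - vecMulVec u v - vecMulVec v u) *ᵥ w = x) :
    w = B⁻¹ *ᵥ x + (v ⬝ᵥ w) • B⁻¹ *ᵥ u + (u ⬝ᵥ w) • B⁻¹ *ᵥ v := by
  have hBw : B *ᵥ w = x + (v ⬝ᵥ w) • u + (u ⬝ᵥ w) • v := by
    rw [← h]
    simp only [sub_mulVec, vecMulVec_mulVec, op_smul_eq_smul]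
    abel
  rw [← mulVec_smul, ← mulVec_smul, ← mulVec_add, ← mulVec_add, ← hBw, mulVec_mulVec,
    nonsing_inv_mul B ((isUnit_iff_isUnit_det B).mp hB), one_mulVec]

/-- Double Sherman–Morrison identity for the rank-two symmetric perturbation
`A + uvᵀ + vuᵀ`: if `G = (zI − A)⁻¹`, `uᵀ G v = 0`, `U = uᵀ G u`, `V = vᵀ G v` and `UV ≠ 1`,
then `zI − A − uvᵀ − vuᵀ` is invertible and `uᵀ (zI − A − uvᵀ − vuᵀ)⁻¹ u = U/(1 − UV)`. -/
theorem double_sherman_morrison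
    {n : ℕ} (A : Matrix (Fin n) (Fin n) ℝ) (hA : A.IsSymm) (z : ℝ)
    (hG : IsUnit (z • (1 : Matrix (Fin n) (Fin n) ℝ) - A))
    (G : Matrix (Fin n) (Fin n) ℝ)
    (hGdef : G = (z • (1 : Matrix (Fin n) (Fin n) ℝ) - A)⁻¹)
    (u v : Fin n → ℝ) (hcross : u ⬝ᵥ G.mulVec v = 0)
    (U V : ℝ) (hU : U = u ⬝ᵥ G.mulVec u) (hV : V = v ⬝ᵥ G.mulVec v)
    (hUV : U * V ≠ 1) :
    IsUnit (z • (1 : Matrix (Fin n) (Fin n) ℝ) - A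
        - Matrix.vecMulVec u v - Matrix.vecMulVec v u) ∧
    u ⬝ᵥ ((z • (1 : Matrix (Fin n) (Fin n) ℝ) - A
        - Matrix.vecMulVec u v - Matrix.vecMulVec v u)⁻¹).mulVec u = U / (1 - U * V) := by
  subst hGdef
  set B := z • (1 : Matrix (Fin n) (Fin n) ℝ) - A with hBdef
  have hBsymm : Bᵀ = B := by simp [hBdef, hA.eq]
  have hcross' : v ⬝ᵥ B⁻¹ *ᵥ u = 0 := by
    rw [dotProduct_mulVec, ← mulVec_transpose, transpose_nonsing_inv, hBsymm, dotProduct_comm,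
      hcross]
  have hUV' : 1 - U * V ≠ 0 := sub_ne_zero.mpr hUV.symm
  have hM : IsUnit (B - vecMulVec u v - vecMulVec v u) := by
    rw [← mulVec_injective_iff_isUnit, ← coe_mulVecLin, injective_iff_map_eq_zero]
    intro w hw
    have key := eq_inv_mulVec_of_rank_two_sub_mulVec_eq hG hw
    have hu := congrArg (u ⬝ᵥ ·) key
    have hv := congrArg (v ⬝ᵥ ·) key
    simp only [mulVec_zero, zero_add, dotProduct_add, dotProduct_smul, smul_eq_mul, hcross,
      hcross', ← hU, ← hV, mul_zero, add_zero] at hu hv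
    have hu0 : u ⬝ᵥ w = 0 :=
      (mul_eq_zero.mp (by linear_combination hu + U * hv :
        (1 - U * V) * (u ⬝ᵥ w) = 0)).resolve_left hUV'
    rw [hu0, zero_mul] at hv
    rw [key, hu0, hv]
    simp
  refine ⟨hM, ?_⟩
  set w := (B - vecMulVec u v - vecMulVec v u)⁻¹ *ᵥ u with hw
  have hMw : (B - vecMulVec u v - vecMulVec v u) *ᵥ w = u := by
    rw [hw, mulVec_mulVec, mul_nonsing_inv _ ((isUnit_iff_isUnit_det _).mp hM), one_mulVec]
  have key := eq_inv_mulVec_of_rank_two_sub_mulVec_eq hG hMw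
  have hu := congrArg (u ⬝ᵥ ·) key
  have hv := congrArg (v ⬝ᵥ ·) key
  simp only [dotProduct_add, dotProduct_smul, smul_eq_mul, hcross, hcross', ← hU, ← hV, mul_zero,
    add_zero, zero_add] at hu hv
  rw [eq_div_iff hUV']
  linear_combination hu + U * hv
end

section
/- Let γ denote the standard Gaussian probability measure on ℝ. Define, for Z ≥ 1, J₁(Z) := ∫ (x² − 1)² / ((Z − 1)x² + 1) dγ(x) and J₂(Z) := ∫ (x² − 1) / ((Z − 1)x² + 1) dγ(x). Then J₁ has derivative −10 at Z = 1 within the interval [1, ∞), and J₂ has derivative −2 at Z = 1 within the interval [1, ∞). -/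
open MeasureTheory ProbabilityTheory

lemma integrable_pow_gaussianReal (n : ℕ) :
    Integrable (fun x : ℝ => x ^ n) (gaussianReal 0 1) := by
  have h := (memLp_id_gaussianReal (μ := 0) (v := 1) n).integrable_norm_pow'
  refine h.mono' (by fun_prop) (ae_of_all _ fun x => ?_)
  simp

lemma integrable_gaussianPDFReal_mul_pow (n : ℕ) :
    Integrable (fun x : ℝ => gaussianPDFReal 0 1 x * x ^ n) := by
  have h := integrable_pow_gaussianReal n
  rw [gaussianReal_of_var_ne_zero _ one_ne_zero,
    integrable_withDensity_iff_integrable_smul' (measurable_gaussianPDF _ _)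
      (ae_of_all _ fun _ => gaussianPDF_lt_top)] at h
  simpa [smul_eq_mul] using h

lemma hasDerivAt_gaussianPDFReal (x : ℝ) :
    HasDerivAt (gaussianPDFReal 0 1) (-x * gaussianPDFReal 0 1 x) x := by
  have h : HasDerivAt (fun y : ℝ => -(y - 0) ^ 2 / (2 * ((1 : NNReal) : ℝ))) (-x) x := by
    refine ((((hasDerivAt_id x).sub_const 0).pow 2).neg.div_const
      (2 * ((1 : NNReal) : ℝ))).congr_deriv ?_
    simp
    ring
  refine (h.exp.const_mul (√(2 * Real.pi * ((1 : NNReal) : ℝ)))⁻¹).congr_deriv ?_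
  simp only [gaussianPDFReal]
  ring

lemma integral_pow_add_two_gaussianReal (n : ℕ) :
    ∫ x, x ^ (n + 2) ∂(gaussianReal 0 1) = (n + 1) * ∫ x, x ^ n ∂(gaussianReal 0 1) := by
  have hderiv (x : ℝ) : HasDerivAt (fun y => gaussianPDFReal 0 1 y * y ^ (n + 1))
      ((n + 1) * (gaussianPDFReal 0 1 x * x ^ n) - gaussianPDFReal 0 1 x * x ^ (n + 2)) x := by
    refine ((hasDerivAt_gaussianPDFReal x).mul (hasDerivAt_pow (n + 1) x)).congr_deriv ?_
    push_cast [Nat.add_sub_cancel]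
    ring
  have h := integral_eq_zero_of_hasDerivAt_of_integrable hderiv
    (((integrable_gaussianPDFReal_mul_pow n).const_mul _).sub
      (integrable_gaussianPDFReal_mul_pow (n + 2)))
    (integrable_gaussianPDFReal_mul_pow (n + 1))
  rw [integral_sub ((integrable_gaussianPDFReal_mul_pow n).const_mul _)
    (integrable_gaussianPDFReal_mul_pow (n + 2)), integral_const_mul] at h
  simp only [integral_gaussianReal_eq_integral_smul (one_ne_zero (α := NNReal)), smul_eq_mul]
  linarith

lemma abs_div_one_add_sub_linear_le {t y : ℝ} (ht : 0 ≤ t) (hy : 0 ≤ y) (a : ℝ) :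
    |a / (t * y + 1) - a + t * (y * a)| ≤ t ^ 2 * |y ^ 2 * a| := by
  have hpos : 0 < t * y + 1 := by positivity
  have h : a / (t * y + 1) - a + t * (y * a) = t ^ 2 * (y ^ 2 * a) / (t * y + 1) := by
    field_simp
    ring
  rw [h, abs_div, abs_mul, abs_of_nonneg (sq_nonneg t), abs_of_pos hpos]
  exact div_le_self (by positivity) (by nlinarith [mul_nonneg ht hy])

lemma hasDerivWithinAt_integral_div_one_add {μ : Measure ℝ} {g : ℝ → ℝ} (hg : Integrable g μ)
    (hg2 : Integrable (fun x => x ^ 2 * g x) μ) (hg4 : Integrable (fun x => x ^ 4 * g x) μ) :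
    HasDerivWithinAt (fun Z : ℝ => ∫ x, g x / ((Z - 1) * x ^ 2 + 1) ∂μ)
      (-∫ x, x ^ 2 * g x ∂μ) (Set.Ici (1 : ℝ)) 1 := by
  have hquot {Z : ℝ} (hZ : 1 ≤ Z) : Integrable (fun x => g x / ((Z - 1) * x ^ 2 + 1)) μ := by
    refine hg.norm.mono' (hg.aestronglyMeasurable.aemeasurable.div
      (by fun_prop)).aestronglyMeasurable (ae_of_all _ fun x => ?_)
    have h1 : 1 ≤ (Z - 1) * x ^ 2 + 1 := by nlinarith [mul_nonneg (sub_nonneg.2 hZ) (sq_nonneg x)]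
    rw [norm_div]
    exact div_le_self (norm_nonneg _) (h1.trans (le_abs_self _))
  have hbound {Z : ℝ} (hZ : 1 ≤ Z) :
      ‖∫ x, g x / ((Z - 1) * x ^ 2 + 1) ∂μ - ∫ x, g x ∂μ + (Z - 1) * ∫ x, x ^ 2 * g x ∂μ‖ ≤
        (∫ x, |x ^ 4 * g x| ∂μ) * ‖(Z - 1) ^ 2‖ := by
    rw [← integral_sub (hquot hZ) hg, ← integral_const_mul,
      ← integral_add (f := fun x => g x / ((Z - 1) * x ^ 2 + 1) - g x)
        ((hquot hZ).sub hg) (hg2.const_mul _), mul_comm, Real.norm_eq_abs ((Z - 1) ^ 2),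
      abs_of_nonneg (sq_nonneg _), ← integral_const_mul]
    refine norm_integral_le_of_norm_le (hg4.abs.const_mul _) (ae_of_all _ fun x => ?_)
    simpa [← pow_mul] using
      abs_div_one_add_sub_linear_le (sub_nonneg.2 hZ) (sq_nonneg x) (g x)
  refine HasDerivWithinAt.of_isLittleO ?_
  have hO : (fun Z : ℝ => ∫ x, g x / ((Z - 1) * x ^ 2 + 1) ∂μ - ∫ x, g x ∂μ
      + (Z - 1) * ∫ x, x ^ 2 * g x ∂μ) =O[nhdsWithin 1 (Set.Ici 1)] fun Z : ℝ => (Z - 1) ^ 2 :=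
    Asymptotics.IsBigO.of_bound _ (eventually_mem_nhdsWithin.mono fun Z hZ => hbound hZ)
  have ho : (fun Z : ℝ => (Z - 1) ^ 2) =o[nhdsWithin 1 (Set.Ici 1)] fun Z : ℝ => Z - 1 :=
    ((Asymptotics.isLittleO_pow_sub_sub (1 : ℝ) one_lt_two).mono nhdsWithin_le_nhds).congr_left
      fun Z => by simp
  refine (hO.trans_isLittleO ho).congr_left fun Z => ?_
  simp

/-- With `γ` the standard Gaussian measure on `ℝ`,
`J₁(Z) = ∫ (x²−1)²/((Z−1)x²+1) dγ` and `J₂(Z) = ∫ (x²−1)/((Z−1)x²+1) dγ` have derivatives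
`−10` and `−2` at `Z = 1` within `[1, ∞)`. -/
theorem gaussian_integrals_deriv_at_one :
    HasDerivWithinAt
      (fun Z : ℝ => ∫ x, (x ^ 2 - 1) ^ 2 / ((Z - 1) * x ^ 2 + 1) ∂(gaussianReal 0 1))
      (-10) (Set.Ici (1 : ℝ)) 1 ∧
    HasDerivWithinAt
      (fun Z : ℝ => ∫ x, (x ^ 2 - 1) / ((Z - 1) * x ^ 2 + 1) ∂(gaussianReal 0 1))
      (-2) (Set.Ici (1 : ℝ)) 1 := by
  have hi := integrable_pow_gaussianReal
  have m2 : ∫ x, x ^ 2 ∂(gaussianReal 0 1) = 1 := by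
    simpa using integral_pow_add_two_gaussianReal 0
  have m4 : ∫ x, x ^ 4 ∂(gaussianReal 0 1) = 3 := by
    rw [integral_pow_add_two_gaussianReal 2, m2]; norm_num
  have m6 : ∫ x, x ^ 6 ∂(gaussianReal 0 1) = 15 := by
    rw [integral_pow_add_two_gaussianReal 4, m4]; norm_num
  have hquartic (k : ℕ) : Integrable (fun x : ℝ => x ^ k * (x ^ 2 - 1) ^ 2) (gaussianReal 0 1) := by
    refine (((hi (k + 4)).sub ((hi (k + 2)).const_mul 2)).add (hi k)).congr
      (ae_of_all _ fun x => ?_)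
    simp only [Pi.add_apply, Pi.sub_apply]
    ring
  have hquadratic (k : ℕ) : Integrable (fun x : ℝ => x ^ k * (x ^ 2 - 1)) (gaussianReal 0 1) := by
    refine ((hi (k + 2)).sub (hi k)).congr (ae_of_all _ fun x => ?_)
    simp only [Pi.sub_apply]
    ring
  constructor
  · convert hasDerivWithinAt_integral_div_one_add (by simpa using hquartic 0) (hquartic 2)
      (hquartic 4) using 1
    have h (x : ℝ) : x ^ 2 * (x ^ 2 - 1) ^ 2 = x ^ 6 - 2 * x ^ 4 + x ^ 2 := by ring
    simp_rw [h]
    rw [integral_add (f := fun x => x ^ 6 - 2 * x ^ 4) ((hi 6).sub ((hi 4).const_mul 2)) (hi 2),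
      integral_sub (hi 6) ((hi 4).const_mul 2), integral_const_mul, m2, m4, m6]
    norm_num
  · convert hasDerivWithinAt_integral_div_one_add (by simpa using hquadratic 0) (hquadratic 2)
      (hquadratic 4) using 1
    have h (x : ℝ) : x ^ 2 * (x ^ 2 - 1) = x ^ 4 - x ^ 2 := by ring
    simp_rw [h]
    rw [integral_sub (hi 4) (hi 2), m2, m4]
    norm_num
end
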